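/- Let R be a unital associative ℂ-algebra, M a left R-module, and f ∈ R such that δ_f is locally nilpotent on R (δ_f(b) = f*b − b*f) and the action of f on M is bijective, with inverse F : M → M. Fix x ∈ ℂ and define a ∗_x v := Σ_{j≥0} binom(x,j) (δ_f^j(a)) • F^j(v). Let N ⊆ M be a ℂ-subspace with f • N ⊆ N and F(N) ⊆ N, and suppose M is generated by N under the original action, i.e. every element of M is a finite sum Σ_i a_i • w_i with a_i ∈ R, w_i ∈ N. Then M is also generated by N under the x-twisted action: every element of M is a finite sum Σ_i a_i ∗_x w_i with a_i ∈ R, w_i ∈ N. -/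

import Mathlib

noncomputable section

/-- The inner derivation `δ_f b = f*b - b*f`. -/
def innerDeriv {R : Type*} [Ring R] (f : R) : R → R := fun b => f * b - b * f

/-- The generalised binomial coefficient `binom(x, j) = x(x-1)⋯(x-j+1)/j!` for `x : ℂ`. -/
def cchoose (x : ℂ) (j : ℕ) : ℂ :=
  (∏ i ∈ Finset.range j, (x - i)) / (j.factorial : ℂ)

/-- Mathieu's `x`-twisted action of `a : R` on `v : M`:
`a ∗ₓ v = ∑_{j ≥ 0} binom(x, j) • (δ_f^[j] a) • F^[j] v`, a finite sum when `δ_f` is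
locally nilpotent, where `F` is the inverse of the (bijective) action of `f` on `M`. -/
def twistedSMul {R M : Type*} [Ring R] [Algebra ℂ R] [AddCommGroup M] [Module R M]
    (f : R) (F : M → M) (x : ℂ) (a : R) (v : M) : M :=
  ∑ᶠ j : ℕ, (algebraMap ℂ R (cchoose x j) * (innerDeriv f)^[j] a) • F^[j] v

theorem innerDeriv_iterate_zero {R : Type*} [Ring R] (f : R) (n : ℕ) :
    (innerDeriv f)^[n] 0 = 0 :=
  Function.iterate_fixed (by simp [innerDeriv]) n

theorem innerDeriv_iterate_eq_zero_of_le {R : Type*} [Ring R] {f a : R} {m n : ℕ}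
    (h : (innerDeriv f)^[m] a = 0) (hmn : m ≤ n) : (innerDeriv f)^[n] a = 0 := by
  obtain ⟨k, rfl⟩ := Nat.exists_eq_add_of_le' hmn
  rw [Function.iterate_add_apply, h, innerDeriv_iterate_zero]

theorem twistedSMul_eq_sum_range {R M : Type*} [Ring R] [Algebra ℂ R] [AddCommGroup M]
    [Module R M] {f : R} (F : M → M) (x : ℂ) {a : R} (v : M) {n : ℕ}
    (h : (innerDeriv f)^[n] a = 0) :
    twistedSMul f F x a v = ∑ j ∈ Finset.range n,
      (algebraMap ℂ R (cchoose x j) * (innerDeriv f)^[j] a) • F^[j] v := by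
  refine finsum_eq_sum_of_support_subset _ fun j hj => ?_
  by_contra hjn
  refine hj ?_
  have hnj : n ≤ j := by simpa using hjn
  simp [innerDeriv_iterate_eq_zero_of_le h hnj]

/-- The finite sums `∑ aᵢ ∗ₓ wᵢ` with all `wᵢ` in `N`. -/
def twistedSpan {R M : Type*} [Ring R] [Algebra ℂ R] [AddCommGroup M] [Module R M]
    (f : R) (F : M → M) (x : ℂ) (N : Set M) : AddSubmonoid M where
  carrier := {v | ∃ (n : ℕ) (a : Fin n → R) (w : Fin n → M),
    (∀ i, w i ∈ N) ∧ v = ∑ i, twistedSMul f F x (a i) (w i)}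
  zero_mem' := ⟨0, Fin.elim0, Fin.elim0, fun i => i.elim0, by simp⟩
  add_mem' := by
    rintro _ _ ⟨m, a, w, hw, rfl⟩ ⟨n, b, u, hu, rfl⟩
    refine ⟨m + n, Fin.append a b, Fin.append w u, fun i => ?_, by simp [Fin.sum_univ_add]⟩
    refine Fin.addCases (fun i => ?_) (fun i => ?_) i
    · simpa using hw i
    · simpa using hu i

theorem twistedSMul_mem_twistedSpan {R M : Type*} [Ring R] [Algebra ℂ R] [AddCommGroup M]
    [Module R M] (f : R) (F : M → M) (x : ℂ) {N : Set M} (a : R) {w : M} (hw : w ∈ N) :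
    twistedSMul f F x a w ∈ twistedSpan f F x N :=
  ⟨1, fun _ => a, fun _ => w, fun _ => hw, by simp⟩

theorem algebraMap_mul_smul_eq {R M : Type*} [Ring R] [Algebra ℂ R] [AddCommGroup M]
    [Module R M] [Module ℂ M] [IsScalarTower ℂ R M] (c : ℂ) (b : R) (v : M) :
    (algebraMap ℂ R c * b) • v = b • c • v := by
  rw [Algebra.commutes, mul_smul, algebraMap_smul]

theorem smul_mem_twistedSpan {R M : Type*} [Ring R] [Algebra ℂ R]
    [AddCommGroup M] [Module R M] [Module ℂ M] [IsScalarTower ℂ R M]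
    {f : R} {F : M → M} (x : ℂ) {N : Submodule ℂ M} (hFN : ∀ w ∈ N, F w ∈ N)
    {n : ℕ} {a : R} (ha : (innerDeriv f)^[n] a = 0) {w : M} (hw : w ∈ N) :
    a • w ∈ twistedSpan f F x (N : Set M) := by
  induction n using Nat.strong_induction_on generalizing a w with
  | _ n ih =>
    cases n with
    | zero =>
      rw [show a = 0 from ha, zero_smul]
      exact zero_mem _
    | succ n =>
      have hiter (j : ℕ) : F^[j] w ∈ N := Set.MapsTo.iterate (s := (N : Set M)) hFN j hw
      have key : a • w = twistedSMul f F x a w + ∑ j ∈ Finset.range n,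
          (innerDeriv f)^[j + 1] a • (-cchoose x (j + 1)) • F^[j + 1] w := by
        rw [twistedSMul_eq_sum_range F x w ha, Finset.sum_range_succ']
        simp only [algebraMap_mul_smul_eq, neg_smul, smul_neg, Finset.sum_neg_distrib]
        simp [cchoose]
      rw [key]
      refine add_mem (twistedSMul_mem_twistedSpan f F x a hw) (sum_mem fun j _ => ?_)
      refine ih n n.lt_succ_self ?_ (N.smul_mem _ (hiter _))
      rw [← Function.iterate_add_apply]
      exact innerDeriv_iterate_eq_zero_of_le ha (by omega)

/-- Let `N ⊆ M` be a `ℂ`-subspace with `f • N ⊆ N` and `F N ⊆ N`.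
If every element of `M` is a finite sum `∑ aᵢ • wᵢ` with `wᵢ ∈ N`, then every element
of `M` is a finite sum `∑ aᵢ ∗ₓ wᵢ` with `wᵢ ∈ N`. -/
theorem twisted_generated_by_subspace {R M : Type*} [Ring R] [Algebra ℂ R]
    [AddCommGroup M] [Module R M] [Module ℂ M] [IsScalarTower ℂ R M]
    (f : R) (F : M → M)
    (hnil : ∀ a : R, ∃ n : ℕ, (innerDeriv f)^[n] a = 0)
    (hFl : ∀ v : M, F (f • v) = v) (hFr : ∀ v : M, f • F v = v)
    (x : ℂ) (N : Submodule ℂ M)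
    (hfN : ∀ w ∈ N, f • w ∈ N) (hFN : ∀ w ∈ N, F w ∈ N)
    (hgen : ∀ v : M, ∃ (n : ℕ) (a : Fin n → R) (w : Fin n → M),
      (∀ i, w i ∈ N) ∧ v = ∑ i, a i • w i) :
    ∀ v : M, ∃ (n : ℕ) (a : Fin n → R) (w : Fin n → M),
      (∀ i, w i ∈ N) ∧ v = ∑ i, twistedSMul f F x (a i) (w i) := by
  intro v
  obtain ⟨n, a, w, hw, rfl⟩ := hgen v
  refine sum_mem (S := twistedSpan f F x (N : Set M)) fun i _ => ?_
  obtain ⟨m, hm⟩ := hnil (a i)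
  exact smul_mem_twistedSpan x hFN hm (hw i)
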